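/- arXiv:2507.19645 — 12 statements merged into one kernel-verified Lean document; each statement's English description precedes it below -/
import Mathlib

section
/- Let n ≥ 2, let x' ∈ ℝ^{n−1} with r := ‖x'‖ > 0, and let p, q, s, t ∈ ℝ. Define the real symmetric n×n matrix H by H_{ij} = q·x'_i·x'_j/r² + (p/r)·(δ_{ij} − x'_i·x'_j/r²) for 1 ≤ i, j ≤ n−1, H_{in} = H_{ni} = s·x'_i/r for 1 ≤ i ≤ n−1, and H_{nn} = t. Then the characteristic polynomial of H equals (X − p/r)^{n−2} · (X² − (q+t)·X + (q·t − s²)); equivalently, the eigenvalues of H counted with multiplicity are p/r with multiplicity n−2 together with λ₋ := ((q+t) − √((q−t)² + 4s²))/2 and λ₊ := ((q+t) + √((q−t)² + 4s²))/2. -/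
open Polynomial

/-- The Hessian matrix of a rotationally symmetric function `W(x) = g(‖x'‖, xₙ)` at a
point with tangential part `x'` (of norm `r = ‖x'‖`), where `p = g_r`, `q = g_{rr}`,
`s = g_{rn}`, `t = g_{nn}`.  The index type `Fin m ⊕ Unit` encodes the coordinates
`x' ∈ ℝ^m` together with the last coordinate `xₙ`. -/
noncomputable def radialHessian {m : ℕ} (x' : EuclideanSpace ℝ (Fin m))
    (p q s t : ℝ) : Matrix (Fin m ⊕ Unit) (Fin m ⊕ Unit) ℝ :=
  Matrix.of fun i j =>
    match i, j with
    | Sum.inl i, Sum.inl j =>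
        q * x' i * x' j / ‖x'‖ ^ 2
          + (p / ‖x'‖) * ((if i = j then 1 else 0) - x' i * x' j / ‖x'‖ ^ 2)
    | Sum.inl i, Sum.inr _ => s * x' i / ‖x'‖
    | Sum.inr _, Sum.inl j => s * x' j / ‖x'‖
    | Sum.inr _, Sum.inr _ => t

/-- The characteristic polynomial of the Hessian of a rotationally symmetric function:
it equals `(X - p/r)^(n-2) * (X² - (q+t)·X + (q·t - s²))`, i.e. the eigenvalues are
`p/r` with multiplicity `n - 2` together with
`λ∓ = ((q+t) ∓ √((q-t)² + 4s²))/2`. -/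
theorem stmt0 (n : ℕ) (hn : 2 ≤ n) (x' : EuclideanSpace ℝ (Fin (n - 1)))
    (hx' : 0 < ‖x'‖) (p q s t : ℝ) :
    (radialHessian x' p q s t).charpoly
      = (X - C (p / ‖x'‖)) ^ (n - 2)
        * (X ^ 2 - C (q + t) * X + C (q * t - s ^ 2)) := by
  have hr : ‖x'‖ ≠ 0 := hx'.ne'
  have hsum : ∑ i, x' i * x' i = ‖x'‖ ^ 2 := by
    rw [EuclideanSpace.norm_sq_eq]
    refine Finset.sum_congr rfl fun i _ => ?_
    rw [Real.norm_eq_abs, sq_abs, sq]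
  let A : Matrix (Fin (n - 1) ⊕ Unit) (Fin 2) ℝ := Matrix.of fun i k =>
    Sum.elim (fun j => ![x' j / ‖x'‖, 0] k) (fun _ => ![0, 1] k) i
  let K : Matrix (Fin 2) (Fin 2) ℝ := !![q - p / ‖x'‖, s; s, t - p / ‖x'‖]
  have hA : A.transpose * A = 1 := by
    ext i j
    have h1 : ∑ i, x' i / ‖x'‖ * (x' i / ‖x'‖) = 1 := by
      simp_rw [div_mul_div_comm]
      rw [← Finset.sum_div, hsum]
      field_simp
    fin_cases i <;> fin_cases j <;> simp [A, Matrix.mul_apply, h1]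
  have hH : radialHessian x' p q s t
      = A * (K * A.transpose) - Matrix.scalar _ (-(p / ‖x'‖)) := by
    ext i j
    rcases i with i | i <;> rcases j with j | j
    · by_cases h : i = j
      · subst h
        simp [radialHessian, A, K, Matrix.mul_apply, Matrix.vecMul, dotProduct, Fin.sum_univ_two]
        field_simp
        ring
      · simp [radialHessian, A, K, Matrix.mul_apply, Matrix.vecMul, dotProduct, Fin.sum_univ_two, h]
        field_simp
        ring
    · simp [radialHessian, A, K, Matrix.mul_apply, Matrix.vecMul, dotProduct, Fin.sum_univ_two]
      field_simp
    · simp [radialHessian, A, K, Matrix.mul_apply, Matrix.vecMul, dotProduct, Fin.sum_univ_two]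
      field_simp
    · simp [radialHessian, A, K, Matrix.mul_apply, Matrix.vecMul, dotProduct, Fin.sum_univ_two]
  have hcard : Fintype.card (Fin (n - 1) ⊕ Unit) = n := by
    simp; omega
  rw [hH, Matrix.charpoly_sub_scalar,
    Matrix.charpoly_mul_comm_of_le _ _ (by rw [hcard]; simpa using hn),
    hcard, Matrix.mul_assoc, hA, Matrix.mul_one, Matrix.charpoly_fin_two]
  simp only [K, Matrix.trace_fin_two, Matrix.det_fin_two]
  simp only [Fintype.card_fin, Matrix.of_apply, Matrix.cons_val', Matrix.cons_val_zero,
    Matrix.cons_val_one, Matrix.cons_val_fin_one, mul_comp, pow_comp, X_comp, sub_comp, add_comp,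
    C_comp, C_neg, C_sub, C_add, C_mul, C_pow]
  rw [sub_eq_add_neg X]
  ring
end

section
/- Let n ≥ 2, let x' ∈ ℝ^{n−1} with r := ‖x'‖ > 0, and let p, q, s, t ∈ ℝ. Define the real symmetric n×n matrix H by H_{ij} = q·x'_i·x'_j/r² + (p/r)·(δ_{ij} − x'_i·x'_j/r²) for 1 ≤ i, j ≤ n−1, H_{in} = H_{ni} = s·x'_i/r for 1 ≤ i ≤ n−1, and H_{nn} = t. Then the trace of H equals (n−2)·(p/r) + q + t, and the determinant of H equals (p/r)^{n−2} · (q·t − s²). -/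
theorem det_aux {m : ℕ} (u : Fin m → ℝ) (hm : 1 ≤ m) (hu : ∑ i, u i * u i = 1) (a q s t : ℝ)
    (M : Matrix (Fin m ⊕ Unit) (Fin m ⊕ Unit) ℝ)
    (U : Matrix (Fin m ⊕ Unit) (Fin 2) ℝ)
    (hU : U = Matrix.of (Sum.elim (fun i => ![u i, 0]) (fun _ => ![0, 1])))
    (hM : M = a • 1 + U * !![q - a, s; s, t - a] * U.transpose) :
    M.det = a ^ (m - 1) * (q * t - s ^ 2) := by
  have hUU : U.transpose * U = 1 := by
    subst hU
    ext i j
    fin_cases i <;> fin_cases j <;> simp [Matrix.mul_apply, hu]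
  have h := Matrix.charpoly_mul_comm_of_le (U * (-!![q - a, s; s, t - a])) U.transpose
    (by simp; omega)
  rw [← Matrix.mul_assoc, hUU, Matrix.one_mul] at h
  have h2 := congrArg (Polynomial.eval a) h
  rw [Polynomial.eval_mul, Matrix.eval_charpoly, Matrix.eval_charpoly] at h2
  have h3 : M = Matrix.scalar (Fin m ⊕ Unit) a -
      U * (-!![q - a, s; s, t - a]) * U.transpose := by
    rw [hM, Matrix.mul_neg, Matrix.neg_mul, sub_neg_eq_add, Matrix.scalar_apply,
      Matrix.smul_one_eq_diagonal]
  have h4 : m + 1 - 2 = m - 1 := by omega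
  rw [h3, h2]
  simp [Matrix.det_fin_two, h4]
  left; ring

/-- The trace of the Hessian of a rotationally symmetric function equals
`(n−2)·(p/r) + q + t` and its determinant equals `(p/r)^(n−2) · (q·t − s²)`. -/
theorem stmt2 (n : ℕ) (hn : 2 ≤ n) (x' : EuclideanSpace ℝ (Fin (n - 1)))
    (hx' : 0 < ‖x'‖) (p q s t : ℝ) :
    (radialHessian x' p q s t).trace = (n - 2 : ℝ) * (p / ‖x'‖) + q + t ∧
    (radialHessian x' p q s t).det = (p / ‖x'‖) ^ (n - 2) * (q * t - s ^ 2) := by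
  have hr : ‖x'‖ ≠ 0 := hx'.ne'
  have hs : ∑ i, x' i * x' i = ‖x'‖ ^ 2 := by
    rw [EuclideanSpace.real_norm_sq_eq]
    exact Finset.sum_congr rfl fun i _ => by ring
  have hu : ∑ i, (x' i / ‖x'‖) * (x' i / ‖x'‖) = 1 := by
    have : ∀ i, (x' i / ‖x'‖) * (x' i / ‖x'‖) = x' i * x' i / ‖x'‖ ^ 2 := fun i => by
      field_simp
    simp_rw [this]
    rw [← Finset.sum_div, hs]
    field_simp
  constructor
  · have e : ∀ i, q * x' i * x' i / ‖x'‖ ^ 2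
          + (p / ‖x'‖) * (1 - x' i * x' i / ‖x'‖ ^ 2) =
          p / ‖x'‖ + (q - p / ‖x'‖) * ((x' i / ‖x'‖) * (x' i / ‖x'‖)) := fun i => by
      field_simp
      ring
    simp only [Matrix.trace, Matrix.diag, Fintype.sum_sum_type, radialHessian, Matrix.of_apply,
      if_true, e]
    rw [Finset.sum_add_distrib, ← Finset.mul_sum, hu]
    simp [Nat.cast_sub (show 1 ≤ n by omega)]
    ring
  · have := det_aux (fun i => x' i / ‖x'‖) (by omega) hu (p / ‖x'‖) q s t
      (radialHessian x' p q s t) _ rfl ?_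
    · rw [this, Nat.sub_sub]
    · ext i j
      rcases i with i | i <;> rcases j with j | j <;>
        simp [radialHessian, Matrix.mul_apply, Fin.sum_univ_two, Matrix.one_apply]
      · split_ifs <;> field_simp <;> ring
      · field_simp
      · field_simp
end

section
/- Let E be a real inner product space, let Ω ⊆ E be a bounded convex set with diam(Ω) ≤ 1, let P belong to the closure of Ω, let ν ∈ E be a unit vector, and let 1 ≤ a ≤ 2 and η > 0. Assume that for every x ∈ Ω one has ⟨x − P, ν⟩ ≥ η·‖(x − P) − ⟨x − P, ν⟩·ν‖^a. Set R := max{1/η, diam(Ω)}. Then Ω is contained in the closed ball of radius R centered at P + R·ν. In particular, Ω satisfies the exterior sphere condition at P with radius R. -/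
open scoped RealInnerProductSpace

/-- A bounded convex domain with `diam Ω ≤ 1` that is of exterior-(a, η)-type at a
point `P` of its closure (expressed coordinate-freely via the unit inward normal `ν`),
with `1 ≤ a ≤ 2`, is contained in the closed ball of radius `R = max{1/η, diam Ω}`
centered at `P + R·ν`; i.e. it satisfies the exterior sphere condition at `P` with
radius `R`. -/
theorem stmt4 {E : Type*} [NormedAddCommGroup E] [InnerProductSpace ℝ E]
    (Ω : Set E) (hΩbd : Bornology.IsBounded Ω) (hΩconv : Convex ℝ Ω)
    (hdiam : Metric.diam Ω ≤ 1)
    (P : E) (hP : P ∈ closure Ω) (ν : E) (hν : ‖ν‖ = 1)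
    (a η : ℝ) (ha1 : 1 ≤ a) (ha2 : a ≤ 2) (hη : 0 < η)
    (hext : ∀ x ∈ Ω, η * ‖(x - P) - ⟪x - P, ν⟫ • ν‖ ^ a ≤ ⟪x - P, ν⟫) :
    Ω ⊆ Metric.closedBall (P + (max (1 / η) (Metric.diam Ω)) • ν)
        (max (1 / η) (Metric.diam Ω)) := by
  intro x hx
  have h := hext x hx
  have hd : ‖x - P‖ ≤ Metric.diam Ω := by
    rw [← dist_eq_norm, ← Metric.diam_closure]
    exact Metric.dist_le_diam_of_mem hΩbd.closure (subset_closure hx) hP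
  set d := Metric.diam Ω
  set R := max (1 / η) d with hR
  have hR1 : 1 / η ≤ R := le_max_left _ _
  have hR2 : d ≤ R := le_max_right _ _
  have hR0 : 0 < R := lt_of_lt_of_le (by positivity) hR1
  rw [Metric.mem_closedBall, dist_eq_norm, ← sub_sub]
  generalize x - P = y at h hd ⊢
  have e1 : ‖y - ⟪y, ν⟫ • ν‖ ^ 2 = ‖y‖ ^ 2 - ⟪y, ν⟫ ^ 2 := by
    rw [norm_sub_sq_real, norm_smul, inner_smul_right, hν, mul_one, Real.norm_eq_abs, sq_abs]
    ring
  have e2 : ‖y - R • ν‖ ^ 2 = ‖y‖ ^ 2 - 2 * R * ⟪y, ν⟫ + R ^ 2 := by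
    rw [norm_sub_sq_real, norm_smul, inner_smul_right, hν, mul_one, Real.norm_eq_abs, sq_abs]
    ring
  have ht : ⟪y, ν⟫ ≤ ‖y‖ := by simpa [hν] using real_inner_le_norm y ν
  generalize ⟪y, ν⟫ = t at *
  have hs0 : 0 ≤ ‖y - t • ν‖ := norm_nonneg _
  generalize ‖y - t • ν‖ = s at *
  have hy := norm_nonneg y
  have hs1 : s ≤ 1 := by nlinarith [sq_nonneg t]
  have hsa : s ^ (2 : ℕ) ≤ s ^ a := by
    rw [← Real.rpow_natCast]
    exact Real.rpow_le_rpow_of_exponent_ge' hs0 hs1 (by linarith) (by simpa using ha2)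
  have hsn : 0 ≤ s ^ a := Real.rpow_nonneg hs0 a
  have ht0 : 0 ≤ t := le_trans (by positivity) h
  have k1 : s ^ a ≤ R * t := by
    calc s ^ a = 1 / η * (η * s ^ a) := by field_simp
      _ ≤ R * t := by gcongr
  have k2 : t ^ 2 ≤ R * t := by nlinarith
  exact abs_le_of_sq_le_sq' (by nlinarith) hR0.le |>.2
end

section
/- Let E be a real inner product space, let P ∈ E, let ν ∈ E be a unit vector, let a ≥ 2 and η > 0, and let 0 < R ≤ min{1/η, 1}. Then the closed ball of radius R centered at P + R·ν is contained in the set {x ∈ E : ⟨x − P, ν⟩ ≥ (η/2)·‖(x − P) − ⟨x − P, ν⟩·ν‖^a}. In particular, a bounded convex domain that is of interior-(a, η, ε)-type at a boundary point P with a ∈ [2, +∞) satisfies the interior sphere condition at P. -/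
open scoped RealInnerProductSpace

/-- For `a ≥ 2`, `η > 0` and `0 < R ≤ min{1/η, 1}`, the closed ball of radius `R`
centered at `P + R·ν` (with `ν` a unit vector) is contained in the coordinate-free
interior cusp region `{x : ⟪x − P, ν⟫ ≥ (η/2)·‖(x − P) − ⟪x − P, ν⟫·ν‖^a}`.
In particular, a bounded convex domain of interior-(a, η, ε)-type at a boundary
point `P` with `a ∈ [2, ∞)` satisfies the interior sphere condition at `P`. -/
theorem stmt5 {E : Type*} [NormedAddCommGroup E] [InnerProductSpace ℝ E]
    (P ν : E) (hν : ‖ν‖ = 1) (a η R : ℝ) (ha : 2 ≤ a) (hη : 0 < η)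
    (hR0 : 0 < R) (hR : R ≤ min (1 / η) 1) :
    Metric.closedBall (P + R • ν) R ⊆
      {x : E | η / 2 * ‖(x - P) - ⟪x - P, ν⟫ • ν‖ ^ a ≤ ⟪x - P, ν⟫} := by
  intro x hx
  have hR1 : R ≤ 1 := hR.trans (min_le_right _ _)
  have hR2 : R * η ≤ 1 := (le_div_iff₀ hη).mp (hR.trans (min_le_left _ _))
  rw [Metric.mem_closedBall, dist_eq_norm] at hx
  have e0 : x - (P + R • ν) = (x - P) - R • ν := by abel
  rw [e0] at hx
  show η / 2 * ‖(x - P) - ⟪x - P, ν⟫ • ν‖ ^ a ≤ ⟪x - P, ν⟫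
  generalize x - P = y at hx ⊢
  have key : ∀ c : ℝ, ‖y - c • ν‖ ^ 2 = ‖y‖ ^ 2 - 2 * c * ⟪y, ν⟫ + c ^ 2 := by
    intro c
    rw [norm_sub_sq_real, inner_smul_right, norm_smul, hν, mul_one, Real.norm_eq_abs, sq_abs]
    ring
  have h1 := key R
  have h2 := key ⟪y, ν⟫
  have hs := norm_nonneg (y - ⟪y, ν⟫ • ν)
  have hx2 : ‖y - R • ν‖ ^ 2 ≤ R ^ 2 := pow_le_pow_left₀ (norm_nonneg _) hx 2
  generalize ‖y - ⟪y, ν⟫ • ν‖ = s at h2 hs ⊢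
  generalize ⟪y, ν⟫ = t at h1 h2 ⊢
  have h3 : s ^ 2 ≤ 2 * R * t - t ^ 2 := by linarith
  have hsR : s ≤ R := abs_le_of_sq_le_sq' (by nlinarith [sq_nonneg (t - R)]) hR0.le |>.2
  have ht : 0 ≤ t := by
    by_contra h
    nlinarith [sq_nonneg s, sq_nonneg t, mul_pos hR0 (neg_pos.mpr (not_le.mp h))]
  have hsa : s ^ a ≤ s ^ 2 := by
    rw [← Real.rpow_two]
    exact Real.rpow_le_rpow_of_exponent_ge_of_imp hs (hsR.trans hR1) ha
      (fun _ h => absurd h (ne_of_gt (lt_of_lt_of_le two_pos ha)))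
  have h4 : η / 2 * s ^ a ≤ η / 2 * (2 * R * t) :=
    mul_le_mul_of_nonneg_left (by nlinarith [sq_nonneg t]) (by positivity)
  have h5 : R * η * t ≤ 1 * t := mul_le_mul_of_nonneg_right hR2 ht
  linarith
end

section
/- Let E be a real inner product space, let y ∈ E, let R > 0, and let P ∈ E with ‖P − y‖ = R. Set ν := (y − P)/R. Then for every x in the closed ball of radius R centered at y one has ⟨x − P, ν⟩ ≥ (1/(2R))·‖(x − P) − ⟨x − P, ν⟩·ν‖². Consequently, any bounded convex domain satisfying the exterior sphere condition with radius R at a boundary point P is of exterior-(2, 1/(2R))-type at P. -/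
open scoped RealInnerProductSpace

/-- If `P` lies on the sphere of radius `R` around `y` and `ν = (y − P)/R`, then every
point `x` of the closed ball of radius `R` around `y` satisfies
`⟪x − P, ν⟫ ≥ (1/(2R))·‖(x − P) − ⟪x − P, ν⟫·ν‖²`.  Consequently, a bounded convex
domain satisfying the exterior sphere condition with radius `R` at a boundary point `P`
is of exterior-(2, 1/(2R))-type at `P`. -/
theorem stmt7 {E : Type*} [NormedAddCommGroup E] [InnerProductSpace ℝ E]
    (y P : E) (R : ℝ) (hR : 0 < R) (hP : ‖P - y‖ = R)
    (ν : E) (hν : ν = R⁻¹ • (y - P)) :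
    ∀ x ∈ Metric.closedBall y R,
      1 / (2 * R) * ‖(x - P) - ⟪x - P, ν⟫ • ν‖ ^ 2 ≤ ⟪x - P, ν⟫ := by
  intro x hx
  have hyP : y - P = R • ν := by
    rw [hν, smul_smul, mul_inv_cancel₀ hR.ne', one_smul]
  have hn : ‖ν‖ = 1 := by
    rw [hν, norm_smul, norm_sub_rev y P, hP, Real.norm_eq_abs, abs_of_pos (inv_pos.mpr hR),
      inv_mul_cancel₀ hR.ne']
  have hd : ‖(x - P) - R • ν‖ ≤ R := by
    rw [← hyP, sub_sub_sub_cancel_right, ← dist_eq_norm]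
    exact Metric.mem_closedBall.mp hx
  have h1 : ‖(x - P) - R • ν‖ ^ 2 ≤ R ^ 2 := pow_le_pow_left₀ (norm_nonneg _) hd 2
  rw [norm_sub_sq_real, inner_smul_right, norm_smul, hn, mul_one, Real.norm_eq_abs, sq_abs] at h1
  have h2 : ‖(x - P) - ⟪x - P, ν⟫ • ν‖ ^ 2 = ‖x - P‖ ^ 2 - ⟪x - P, ν⟫ ^ 2 := by
    rw [norm_sub_sq_real, inner_smul_right, norm_smul, hn, mul_one, Real.norm_eq_abs, sq_abs]
    ring
  rw [h2, one_div, inv_mul_le_iff₀ (by positivity)]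
  nlinarith [sq_nonneg ⟪x - P, ν⟫]
end

section
/- Let Ω ⊆ ℝⁿ be a bounded convex open set, and let u be a real-valued function that is continuous on the closure of Ω and convex on the closure of Ω. Let x₁ and x₂ be two distinct points of the frontier of Ω, let 0 ≤ s ≤ t ≤ 1, and set y₁ := x₁ + s·(x₂ − x₁) and y₂ := x₁ + t·(x₂ − x₁). Then |u(y₂) − u(y₁)| ≤ max{ |u(x₁ + (y₂ − y₁)) − u(x₁)| , |u(x₂ − (y₂ − y₁)) − u(x₂)| }. -/
theorem convex_incr_aux (g : ℝ → ℝ) (hg : ConvexOn ℝ (Set.Icc 0 1) g) (a c h : ℝ)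
    (ha : 0 ≤ a) (hac : a ≤ c) (hh : 0 ≤ h) (hc : c + h ≤ 1) :
    g (a + h) - g a ≤ g (c + h) - g c := by
  rcases eq_or_lt_of_le (show 0 ≤ c + h - a by linarith) with hL | hL
  · have h0 : h = 0 := by linarith
    subst h0
    simp
  · have hA : a ∈ Set.Icc (0:ℝ) 1 := ⟨ha, by linarith⟩
    have hB : c + h ∈ Set.Icc (0:ℝ) 1 := ⟨by linarith, hc⟩
    obtain ⟨w, hw⟩ : ∃ w, w = h / (c + h - a) := ⟨_, rfl⟩
    have hw0 : 0 ≤ w := by rw [hw]; positivity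
    have hw1 : w ≤ 1 := by rw [hw, div_le_one hL]; linarith
    have hwL : w * (c + h - a) = h := by rw [hw]; field_simp
    have h1 := hg.2 hA hB (show 0 ≤ 1 - w by linarith) hw0 (by ring)
    have h2 := hg.2 hA hB hw0 (show 0 ≤ 1 - w by linarith) (by ring)
    simp only [smul_eq_mul] at h1 h2
    rw [show (1 - w) * a + w * (c + h) = a + h by linarith] at h1
    rw [show w * a + (1 - w) * (c + h) = c by linarith] at h2
    linarith

/-- Monotonicity estimate for convex functions on convex domains: if `x₁, x₂ ∈ ∂Ω` are
distinct, `0 ≤ s ≤ t ≤ 1`, `y₁ = x₁ + s(x₂ − x₁)` and `y₂ = x₁ + t(x₂ − x₁)`, then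
`|u(y₂) − u(y₁)| ≤ max{|u(x₁ + (y₂−y₁)) − u(x₁)|, |u(x₂ − (y₂−y₁)) − u(x₂)|}`. -/
theorem stmt8 (n : ℕ) (Ω : Set (EuclideanSpace ℝ (Fin n)))
    (hΩbd : Bornology.IsBounded Ω) (hΩconv : Convex ℝ Ω) (hΩopen : IsOpen Ω)
    (u : EuclideanSpace ℝ (Fin n) → ℝ)
    (hu_cont : ContinuousOn u (closure Ω)) (hu_conv : ConvexOn ℝ (closure Ω) u)
    (x₁ x₂ : EuclideanSpace ℝ (Fin n)) (hx₁ : x₁ ∈ frontier Ω) (hx₂ : x₂ ∈ frontier Ω)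
    (hne : x₁ ≠ x₂) (s t : ℝ) (hs : 0 ≤ s) (hst : s ≤ t) (ht : t ≤ 1) :
    |u (x₁ + t • (x₂ - x₁)) - u (x₁ + s • (x₂ - x₁))| ≤
      max |u (x₁ + (t - s) • (x₂ - x₁)) - u x₁|
          |u (x₂ - (t - s) • (x₂ - x₁)) - u x₂| := by
  have hg : ConvexOn ℝ (Set.Icc (0:ℝ) 1) (fun r : ℝ => u (x₁ + r • (x₂ - x₁))) := by
    have h1 := hu_conv.comp_affineMap (AffineMap.lineMap (k := ℝ) x₁ x₂)
    have h2 := h1.subset (s := Set.Icc (0:ℝ) 1) (fun r hr => by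
      exact hΩconv.closure.lineMap_mem (frontier_subset_closure hx₁)
        (frontier_subset_closure hx₂) hr) (convex_Icc 0 1)
    have h3 : (fun r : ℝ => u (x₁ + r • (x₂ - x₁))) =
        u ∘ (AffineMap.lineMap (k := ℝ) x₁ x₂) := by
      funext r
      simp [AffineMap.lineMap_apply, add_comm]
    rw [h3]
    exact h2
  have e1 := convex_incr_aux _ hg 0 s (t - s) le_rfl hs (by linarith) (by linarith)
  have e2 := convex_incr_aux _ hg s (1 - (t - s)) (t - s) hs (by linarith) (by linarith)
    (by linarith)
  have k1 : x₂ - (t - s) • (x₂ - x₁) = x₁ + (1 - (t - s)) • (x₂ - x₁) := by module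
  rw [k1]
  simp only [zero_add, zero_smul, add_zero, add_sub_cancel, sub_add_cancel, one_smul] at e1 e2
  rw [abs_le]
  constructor
  · have := neg_abs_le (u (x₁ + (t - s) • (x₂ - x₁)) - u x₁)
    have := le_max_left |u (x₁ + (t - s) • (x₂ - x₁)) - u x₁|
      |u (x₁ + (1 - (t - s)) • (x₂ - x₁)) - u x₂|
    linarith
  · have := neg_abs_le (u (x₁ + (1 - (t - s)) • (x₂ - x₁)) - u x₂)
    have := le_max_right |u (x₁ + (t - s) • (x₂ - x₁)) - u x₁|
      |u (x₁ + (1 - (t - s)) • (x₂ - x₁)) - u x₂|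
    linarith
end

section
/- Let 0 < ν ≤ μ ≤ 1, let 0 < m ≤ M, let D > 0, and let p > 0 and 0 < q ≤ D be real numbers satisfying M·p^μ = m·q^ν. Then q/p ≤ (1 + D^{1 − ν/μ})·(M/m)^{1/μ}, and consequently p/(p + q) ≥ 1/(1 + (1 + D^{1 − ν/μ})·(M/m)^{1/μ}). -/
/-- Scalar inequality underlying the lower bound on the domain ratio: if
`0 < ν ≤ μ ≤ 1`, `0 < m ≤ M`, `D > 0`, `p > 0`, `0 < q ≤ D` and `M·p^μ = m·q^ν`, then
`q/p ≤ (1 + D^{1−ν/μ})·(M/m)^{1/μ}` and hence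
`p/(p+q) ≥ 1/(1 + (1 + D^{1−ν/μ})·(M/m)^{1/μ})`. -/
theorem stmt10 (μ ν m M D p q : ℝ)
    (hν0 : 0 < ν) (hνμ : ν ≤ μ) (hμ1 : μ ≤ 1)
    (hm0 : 0 < m) (hmM : m ≤ M) (hD : 0 < D)
    (hp : 0 < p) (hq0 : 0 < q) (hqD : q ≤ D)
    (heq : M * p ^ μ = m * q ^ ν) :
    q / p ≤ (1 + D ^ (1 - ν / μ)) * (M / m) ^ (1 / μ) ∧
    1 / (1 + (1 + D ^ (1 - ν / μ)) * (M / m) ^ (1 / μ)) ≤ p / (p + q) := by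
  have hμ : 0 < μ := hν0.trans_le hνμ
  have hM : 0 < M := hm0.trans_le hmM
  have hK : 0 < (M / m) ^ (1 / μ) := Real.rpow_pos_of_pos (div_pos hM hm0) _
  have hE : 0 < D ^ (1 - ν / μ) := Real.rpow_pos_of_pos hD _
  have h1 : q ^ ν = (M / m) * p ^ μ := by
    field_simp
    linarith
  have h2 : q ^ (ν / μ) = (M / m) ^ (1 / μ) * p := by
    have h3 : q ^ (ν / μ) = (q ^ ν) ^ (1 / μ) := by
      rw [← Real.rpow_mul hq0.le]
      congr 1
      ring
    rw [h3, h1, Real.mul_rpow (div_pos hM hm0).le (Real.rpow_pos_of_pos hp _).le,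
      ← Real.rpow_mul hp.le, mul_one_div_cancel hμ.ne', Real.rpow_one]
  have h4 : q = q ^ (1 - ν / μ) * q ^ (ν / μ) := by
    rw [← Real.rpow_add hq0, sub_add_cancel, Real.rpow_one]
  have h5 : q ^ (1 - ν / μ) ≤ D ^ (1 - ν / μ) :=
    Real.rpow_le_rpow hq0.le hqD (sub_nonneg.2 ((div_le_one hμ).2 hνμ))
  rw [h2] at h4
  have hKp := mul_pos hK hp
  have h6 : q ≤ (1 + D ^ (1 - ν / μ)) * (M / m) ^ (1 / μ) * p := by
    have h7 := mul_le_mul_of_nonneg_right h5 hKp.le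
    linarith
  refine ⟨(div_le_iff₀ hp).2 h6, ?_⟩
  have hC : 0 < (1 + D ^ (1 - ν / μ)) * (M / m) ^ (1 / μ) := by positivity
  rw [div_le_div_iff₀ (by linarith) (by linarith)]
  linarith
end

section
/- Let a ≥ 2, b > 1, δ ∈ (0, 1), ξ > 0, x_n > 0 and r ≥ 0 with r² ≤ δ·(x_n/ξ)^{2/a}. Set w := ((x_n/ξ)^{2/a} − r²)^{1/b}, W_rr := (2/b)·w^{1−b} + (4(b−1)/b²)·w^{1−2b}·r², W_nn := (2(a−2)/(a²b))·w^{1−b}·(x_n/ξ)^{(2/a)−2}·ξ^{−2} + (4(b−1)/(a²b²))·w^{1−2b}·(x_n/ξ)^{(4/a)−2}·ξ^{−2}, and W_rn := (4(1−b)/(ab²))·w^{1−2b}·r·(x_n/ξ)^{(2/a)−1}·ξ^{−1}. Then W_rr·W_nn − W_rn² ≥ (8(b−1)/(a²b³))·(1−δ)^{a−2} · w^{2−b−ab} · ξ^{−2}. -/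
/-- Lower bound `W_rr·W_nn − W_rn² ≥ C₁(a,b,δ)·w^{2−b−ab}·ξ^{−2}` with
`C₁ = (8(b−1)/(a²b³))·(1−δ)^{a−2}`, for the barrier
`W(r, xₙ) = −((xₙ/ξ)^{2/a} − r²)^{1/b}` (so `w = |W|`) in Step 1-1
(`a ≥ 2`, `b > 1`) of the subsolution construction, at a point satisfying the cone
condition `r² ≤ δ·(xₙ/ξ)^{2/a}`. -/
theorem stmt12 (a b δ ξ xn r : ℝ)
    (ha : 2 ≤ a) (hb : 1 < b) (hδ0 : 0 < δ) (hδ1 : δ < 1) (hξ : 0 < ξ)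
    (hxn : 0 < xn) (hr : 0 ≤ r) (hcone : r ^ 2 ≤ δ * (xn / ξ) ^ (2 / a))
    (w Wrr Wnn Wrn : ℝ)
    (hw : w = ((xn / ξ) ^ (2 / a) - r ^ 2) ^ (1 / b))
    (hWrr : Wrr = 2 / b * w ^ (1 - b)
        + 4 * (b - 1) / b ^ 2 * w ^ (1 - 2 * b) * r ^ 2)
    (hWnn : Wnn = 2 * (a - 2) / (a ^ 2 * b) * w ^ (1 - b)
          * (xn / ξ) ^ (2 / a - 2) * ξ ^ (-2 : ℝ)
        + 4 * (b - 1) / (a ^ 2 * b ^ 2) * w ^ (1 - 2 * b)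
          * (xn / ξ) ^ (4 / a - 2) * ξ ^ (-2 : ℝ))
    (hWrn : Wrn = 4 * (1 - b) / (a * b ^ 2) * w ^ (1 - 2 * b) * r
        * (xn / ξ) ^ (2 / a - 1) * ξ ^ (-1 : ℝ)) :
    8 * (b - 1) / (a ^ 2 * b ^ 3) * (1 - δ) ^ (a - 2)
        * w ^ (2 - b - a * b) * ξ ^ (-2 : ℝ)
      ≤ Wrr * Wnn - Wrn ^ 2 := by
  have hy : 0 < xn / ξ := div_pos hxn hξ
  generalize xn / ξ = y at *
  have hT : 0 < y ^ (2 / a) := Real.rpow_pos_of_pos hy _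
  have hd : 0 < 1 - δ := by linarith
  have hsT : (1 - δ) * y ^ (2 / a) ≤ y ^ (2 / a) - r ^ 2 := by linarith
  have hs : 0 < y ^ (2 / a) - r ^ 2 := lt_of_lt_of_le (mul_pos hd hT) hsT
  have hw0 : 0 < w := by rw [hw]; exact Real.rpow_pos_of_pos hs _
  have hb0 : 0 < b := by linarith
  have ha0 : 0 < a := by linarith
  have hwb : w ^ b = y ^ (2 / a) - r ^ 2 := by
    rw [hw, ← Real.rpow_mul hs.le, one_div_mul_cancel hb0.ne', Real.rpow_one]
  -- key comparison
  have hkey : (1 - δ) ^ (a - 2) * w ^ (2 * b - a * b) ≤ y ^ (4 / a - 2) := by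
    have e1 : w ^ (2 * b - a * b) = (w ^ b) ^ (2 - a) := by
      rw [← Real.rpow_mul hw0.le]; congr 1; ring
    have e2 : y ^ (4 / a - 2) = (y ^ (2 / a)) ^ (2 - a) := by
      rw [← Real.rpow_mul hy.le]; congr 1; field_simp; ring
    have h1 : (w ^ b) ^ (2 - a) ≤ ((1 - δ) * y ^ (2 / a)) ^ (2 - a) :=
      Real.rpow_le_rpow_of_nonpos (mul_pos hd hT) (by rw [hwb]; exact hsT) (by linarith)
    rw [Real.mul_rpow hd.le hT.le] at h1
    have h2 : (1 - δ) ^ (a - 2) * (1 - δ) ^ (2 - a) = 1 := by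
      rw [← Real.rpow_add hd]; simp
    rw [e1, e2]
    calc _ ≤ (1 - δ) ^ (a - 2) * ((1 - δ) ^ (2 - a) * (y ^ (2 / a)) ^ (2 - a)) :=
          mul_le_mul_of_nonneg_left h1 (Real.rpow_nonneg hd.le _)
      _ = _ := by rw [← mul_assoc, h2, one_mul]
  have hw2 : w ^ (2 - b - a * b) = w ^ (1 - b) * w ^ (1 - 2 * b) * w ^ (2 * b - a * b) := by
    rw [← Real.rpow_add hw0, ← Real.rpow_add hw0]; congr 1; ring
  have hy2 : y ^ (4 / a - 2) = (y ^ (2 / a - 1)) ^ 2 := by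
    rw [← Real.rpow_natCast, ← Real.rpow_mul hy.le]; congr 1; push_cast; ring
  have hx2 : ξ ^ (-2 : ℝ) = (ξ ^ (-1 : ℝ)) ^ 2 := by
    rw [← Real.rpow_natCast, ← Real.rpow_mul hξ.le]; congr 1; norm_num
  have hp : 0 < w ^ (1 - b) := Real.rpow_pos_of_pos hw0 _
  have hq : 0 < w ^ (1 - 2 * b) := Real.rpow_pos_of_pos hw0 _
  have hz : 0 < y ^ (2 / a - 2) := Real.rpow_pos_of_pos hy _
  have hx : 0 < ξ ^ (-1 : ℝ) := Real.rpow_pos_of_pos hξ _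
  rw [hWrr, hWnn, hWrn, hw2, hx2]
  rw [hy2] at hkey ⊢
  generalize w ^ (1 - b) = p at *
  generalize w ^ (1 - 2 * b) = q at *
  generalize y ^ (2 / a - 2) = z at *
  generalize ξ ^ (-1 : ℝ) = x at *
  generalize y ^ (2 / a - 1) = u at *
  generalize w ^ (2 * b - a * b) = v at *
  generalize (1 - δ) ^ (a - 2) = d at *
  have ha2 : 0 ≤ a - 2 := by linarith
  have hb1 : 0 < b - 1 := by linarith
  have hA : 0 ≤ 4 * (a - 2) / (a ^ 2 * b ^ 2) * p ^ 2 * z * x ^ 2 := by positivity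
  have hB : 0 ≤ 8 * (b - 1) * (a - 2) / (a ^ 2 * b ^ 3) * p * q * r ^ 2 * z * x ^ 2 := by
    positivity
  have hC : 8 * (b - 1) / (a ^ 2 * b ^ 3) * p * q * x ^ 2 * (d * v)
      ≤ 8 * (b - 1) / (a ^ 2 * b ^ 3) * p * q * x ^ 2 * u ^ 2 :=
    mul_le_mul_of_nonneg_left hkey (by positivity)
  have hE : (2 / b * p + 4 * (b - 1) / b ^ 2 * q * r ^ 2) *
      (2 * (a - 2) / (a ^ 2 * b) * p * z * x ^ 2
        + 4 * (b - 1) / (a ^ 2 * b ^ 2) * q * u ^ 2 * x ^ 2)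
      - (4 * (1 - b) / (a * b ^ 2) * q * r * u * x) ^ 2
      = 4 * (a - 2) / (a ^ 2 * b ^ 2) * p ^ 2 * z * x ^ 2
        + 8 * (b - 1) * (a - 2) / (a ^ 2 * b ^ 3) * p * q * r ^ 2 * z * x ^ 2
        + 8 * (b - 1) / (a ^ 2 * b ^ 3) * p * q * x ^ 2 * u ^ 2 := by
    field_simp
    ring
  rw [hE]
  linarith
end

section
/- Let a ≥ 2, b > 1, δ ∈ (0, 1), ξ > 0, x_n > 0 and r ≥ 0 with r² ≤ δ·(x_n/ξ)^{2/a}. Set w := ((x_n/ξ)^{2/a} − r²)^{1/b}, W_rr := (2/b)·w^{1−b} + (4(b−1)/b²)·w^{1−2b}·r², W_nn := (2(a−2)/(a²b))·w^{1−b}·(x_n/ξ)^{(2/a)−2}·ξ^{−2} + (4(b−1)/(a²b²))·w^{1−2b}·(x_n/ξ)^{(4/a)−2}·ξ^{−2}, and W_rn := (4(1−b)/(ab²))·w^{1−2b}·r·(x_n/ξ)^{(2/a)−1}·ξ^{−1}. Then W_rr·W_nn − W_rn² ≤ (2/b + (4(b−1)/b²)·δ·(1−δ)^{−1}) · (2(a−2)/(a²b)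 + 4(b−1)/(a²b²)) · w^{2−b−ab} · ξ^{−2}. -/
/-- Upper bound `W_rr·W_nn − W_rn² ≤ C₂(a,b,δ)·w^{2−b−ab}·ξ^{−2}` with
`C₂ = (2/b + (4(b−1)/b²)·δ(1−δ)⁻¹)·(2(a−2)/(a²b) + 4(b−1)/(a²b²))`, for the barrier
`W(r, xₙ) = −((xₙ/ξ)^{2/a} − r²)^{1/b}` (so `w = |W|`) in Step 1-1
(`a ≥ 2`, `b > 1`) of the subsolution construction, at a point satisfying the cone
condition `r² ≤ δ·(xₙ/ξ)^{2/a}`. -/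
theorem stmt13 (a b δ ξ xn r : ℝ)
    (ha : 2 ≤ a) (hb : 1 < b) (hδ0 : 0 < δ) (hδ1 : δ < 1) (hξ : 0 < ξ)
    (hxn : 0 < xn) (hr : 0 ≤ r) (hcone : r ^ 2 ≤ δ * (xn / ξ) ^ (2 / a))
    (w Wrr Wnn Wrn : ℝ)
    (hw : w = ((xn / ξ) ^ (2 / a) - r ^ 2) ^ (1 / b))
    (hWrr : Wrr = 2 / b * w ^ (1 - b)
        + 4 * (b - 1) / b ^ 2 * w ^ (1 - 2 * b) * r ^ 2)
    (hWnn : Wnn = 2 * (a - 2) / (a ^ 2 * b) * w ^ (1 - b)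
          * (xn / ξ) ^ (2 / a - 2) * ξ ^ (-2 : ℝ)
        + 4 * (b - 1) / (a ^ 2 * b ^ 2) * w ^ (1 - 2 * b)
          * (xn / ξ) ^ (4 / a - 2) * ξ ^ (-2 : ℝ))
    (hWrn : Wrn = 4 * (1 - b) / (a * b ^ 2) * w ^ (1 - 2 * b) * r
        * (xn / ξ) ^ (2 / a - 1) * ξ ^ (-1 : ℝ)) :
    Wrr * Wnn - Wrn ^ 2 ≤
      (2 / b + 4 * (b - 1) / b ^ 2 * δ * (1 - δ)⁻¹)
        * (2 * (a - 2) / (a ^ 2 * b) + 4 * (b - 1) / (a ^ 2 * b ^ 2))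
        * w ^ (2 - b - a * b) * ξ ^ (-2 : ℝ) := by
  have hX : 0 < xn / ξ := div_pos hxn hξ
  have ha0 : 0 < a := by linarith
  have hb0 : 0 < b := by linarith
  have hb1 : 0 ≤ b - 1 := by linarith
  have ha2 : 0 ≤ a - 2 := by linarith
  have hd : 0 < 1 - δ := by linarith
  have e1 : (xn / ξ) ^ (2 / a - 2) = ((xn / ξ) ^ (2 / a)) ^ (1 - a) := by
    rw [← Real.rpow_mul hX.le]; congr 1; field_simp
  have e2 : (xn / ξ) ^ (4 / a - 2) = ((xn / ξ) ^ (2 / a)) ^ (2 - a) := by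
    rw [← Real.rpow_mul hX.le]; congr 1; field_simp; ring
  rw [e1, e2] at hWnn
  have hP : 0 < (xn / ξ) ^ (2 / a) := Real.rpow_pos_of_pos hX _
  generalize (xn / ξ) ^ (2 / a) = P at *
  have hS : 0 < P - r ^ 2 := by
    have := mul_pos hd hP
    linarith
  have hw0 : 0 < w := by rw [hw]; exact Real.rpow_pos_of_pos hS _
  have hwb : w ^ b = P - r ^ 2 := by
    rw [hw, ← Real.rpow_mul hS.le, one_div_mul_cancel hb0.ne', Real.rpow_one]
  have hwP : w ^ b ≤ P := by rw [hwb]; linarith [sq_nonneg r]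
  have hwb0 : 0 < w ^ b := Real.rpow_pos_of_pos hw0 _
  have hr2 : r ^ 2 ≤ δ * (1 - δ)⁻¹ * w ^ b := by
    rw [hwb, mul_right_comm, ← div_eq_mul_inv, le_div_iff₀ hd]; linarith
  have p1 : P ^ (1 - a) ≤ w ^ (b * (1 - a)) := by
    rw [Real.rpow_mul hw0.le]
    exact Real.rpow_le_rpow_of_nonpos hwb0 hwP (by linarith)
  have p2 : P ^ (2 - a) ≤ w ^ (b * (2 - a)) := by
    rw [Real.rpow_mul hw0.le]
    exact Real.rpow_le_rpow_of_nonpos hwb0 hwP (by linarith)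
  have q1 : w ^ (1 - b) * w ^ (b * (1 - a)) = w ^ (1 - a * b) := by
    rw [← Real.rpow_add hw0]; congr 1; ring
  have q2 : w ^ (1 - 2 * b) * w ^ (b * (2 - a)) = w ^ (1 - a * b) := by
    rw [← Real.rpow_add hw0]; congr 1; ring
  have q3 : w ^ (1 - 2 * b) * w ^ b = w ^ (1 - b) := by
    rw [← Real.rpow_add hw0]; congr 1; ring
  have q4 : w ^ (1 - b) * w ^ (1 - a * b) = w ^ (2 - b - a * b) := by
    rw [← Real.rpow_add hw0]; congr 1; ring
  have n1 : 0 < w ^ (1 - b) := Real.rpow_pos_of_pos hw0 _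
  have n2 : 0 < w ^ (1 - 2 * b) := Real.rpow_pos_of_pos hw0 _
  have n3 : 0 < ξ ^ (-2 : ℝ) := Real.rpow_pos_of_pos hξ _
  have n4 : 0 < P ^ (1 - a) := Real.rpow_pos_of_pos hP _
  have n5 : 0 < P ^ (2 - a) := Real.rpow_pos_of_pos hP _
  have hrr : Wrr ≤ (2 / b + 4 * (b - 1) / b ^ 2 * δ * (1 - δ)⁻¹) * w ^ (1 - b) := by
    have h : 4 * (b - 1) / b ^ 2 * w ^ (1 - 2 * b) * r ^ 2
        ≤ 4 * (b - 1) / b ^ 2 * w ^ (1 - 2 * b) * (δ * (1 - δ)⁻¹ * w ^ b) :=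
      mul_le_mul_of_nonneg_left hr2 (by positivity)
    rw [hWrr]
    refine (add_le_add_right h _).trans (le_of_eq ?_)
    rw [← q3]; ring
  have hnn : Wnn ≤ (2 * (a - 2) / (a ^ 2 * b) + 4 * (b - 1) / (a ^ 2 * b ^ 2))
      * w ^ (1 - a * b) * ξ ^ (-2 : ℝ) := by
    have h1 := mul_le_mul_of_nonneg_right (mul_le_mul_of_nonneg_left p1
      (show 0 ≤ 2 * (a - 2) / (a ^ 2 * b) * w ^ (1 - b) by positivity)) n3.le
    have h2 := mul_le_mul_of_nonneg_right (mul_le_mul_of_nonneg_left p2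
      (show 0 ≤ 4 * (b - 1) / (a ^ 2 * b ^ 2) * w ^ (1 - 2 * b) by positivity)) n3.le
    rw [hWnn]
    refine (add_le_add h1 h2).trans (le_of_eq ?_)
    rw [mul_assoc _ (w ^ (1 - b)), q1, mul_assoc _ (w ^ (1 - 2 * b)), q2]; ring
  have hnn0 : 0 ≤ Wnn := by rw [hWnn]; positivity
  have hC : 0 ≤ (2 / b + 4 * (b - 1) / b ^ 2 * δ * (1 - δ)⁻¹) * w ^ (1 - b) := by
    positivity
  have hm := mul_le_mul hrr hnn hnn0 hC
  rw [← q4]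
  refine (sub_le_self _ (sq_nonneg Wrn)).trans (hm.trans (le_of_eq ?_))
  ring
end

section
/- Let a ≥ 2, b > 1, δ ∈ (0, 1), 0 < ξ < 1, D > 0, 0 < x_n ≤ D and r ≥ 0 with r² ≤ δ·(x_n/ξ)^{2/a}. Set w := ((x_n/ξ)^{2/a} − r²)^{1/b}, W_rr := (2/b)·w^{1−b} + (4(b−1)/b²)·w^{1−2b}·r², and W_nn := (2(a−2)/(a²b))·w^{1−b}·(x_n/ξ)^{(2/a)−2}·ξ^{−2} + (4(b−1)/(a²b²))·w^{1−2b}·(x_n/ξ)^{(4/a)−2}·ξ^{−2}. Then W_rr + W_nn ≤ [ (2/b + (4(b−1)/b²)·δ·(1−δ)^{−1})·D^{2−2/a} + 2(a−2)/(a²b) + 4(b−1)/(a²b²) ] · w^{1−ab} · ξ^{−2}. -/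
/-- Upper bound `W_rr + W_nn ≤ C₃(a,b,δ,D)·w^{1−ab}·ξ^{−2}` with
`C₃ = (2/b + (4(b−1)/b²)·δ(1−δ)⁻¹)·D^{2−2/a} + 2(a−2)/(a²b) + 4(b−1)/(a²b²)`, for the
barrier `W(r, xₙ) = −((xₙ/ξ)^{2/a} − r²)^{1/b}` (so `w = |W|`) in Step 1-1
(`a ≥ 2`, `b > 1`) of the subsolution construction, at a point satisfying the cone
condition `r² ≤ δ·(xₙ/ξ)^{2/a}` and `0 < xₙ ≤ D` (with `D` playing the role of
`diam Ω`). -/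
theorem stmt14 (a b δ ξ D xn r : ℝ)
    (ha : 2 ≤ a) (hb : 1 < b) (hδ0 : 0 < δ) (hδ1 : δ < 1)
    (hξ0 : 0 < ξ) (hξ1 : ξ < 1) (hD : 0 < D)
    (hxn : 0 < xn) (hxnD : xn ≤ D) (hr : 0 ≤ r)
    (hcone : r ^ 2 ≤ δ * (xn / ξ) ^ (2 / a))
    (w Wrr Wnn : ℝ)
    (hw : w = ((xn / ξ) ^ (2 / a) - r ^ 2) ^ (1 / b))
    (hWrr : Wrr = 2 / b * w ^ (1 - b)
        + 4 * (b - 1) / b ^ 2 * w ^ (1 - 2 * b) * r ^ 2)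
    (hWnn : Wnn = 2 * (a - 2) / (a ^ 2 * b) * w ^ (1 - b)
          * (xn / ξ) ^ (2 / a - 2) * ξ ^ (-2 : ℝ)
        + 4 * (b - 1) / (a ^ 2 * b ^ 2) * w ^ (1 - 2 * b)
          * (xn / ξ) ^ (4 / a - 2) * ξ ^ (-2 : ℝ)) :
    Wrr + Wnn ≤
      ((2 / b + 4 * (b - 1) / b ^ 2 * δ * (1 - δ)⁻¹) * D ^ (2 - 2 / a)
          + 2 * (a - 2) / (a ^ 2 * b) + 4 * (b - 1) / (a ^ 2 * b ^ 2))
        * w ^ (1 - a * b) * ξ ^ (-2 : ℝ) := by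
  have ha0 : 0 < a := by linarith
  have hb0 : 0 < b := by linarith
  have ht : 0 < xn / ξ := div_pos hxn hξ0
  have h1δ : 0 < 1 - δ := by linarith
  obtain ⟨t, htdef⟩ : ∃ t, t = xn / ξ := ⟨_, rfl⟩
  rw [← htdef] at ht hcone hw hWnn
  obtain ⟨s, hs⟩ : ∃ s, s = t ^ (2 / a) := ⟨_, rfl⟩
  have hs0 : 0 < s := by rw [hs]; positivity
  rw [← hs] at hcone hw
  obtain ⟨u, hu⟩ : ∃ u, u = s - r ^ 2 := ⟨_, rfl⟩
  rw [← hu] at hw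
  have hus : u ≤ s := by nlinarith [sq_nonneg r]
  have hu1 : (1 - δ) * s ≤ u := by rw [hu]; linarith
  have hu0 : 0 < u := lt_of_lt_of_le (mul_pos h1δ hs0) hu1
  have hw0 : 0 < w := by rw [hw]; positivity
  have hwu : ∀ c : ℝ, w ^ (b * c) = u ^ c := by
    intro c
    rw [hw, ← Real.rpow_mul hu0.le]
    congr 1
    field_simp
  have e1 : w ^ (1 - b) = w ^ (1 - a * b) * u ^ (a - 1) := by
    rw [← hwu, ← Real.rpow_add hw0]; congr 1; ring
  have e2 : w ^ (1 - 2 * b) = w ^ (1 - a * b) * u ^ (a - 2) := by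
    rw [← hwu, ← Real.rpow_add hw0]; congr 1; ring
  have e3 : u ^ (a - 1) = u ^ (a - 2) * u := by
    rw [← Real.rpow_add_one hu0.ne']; congr 1; ring
  have b1 : u ^ (a - 1) ≤ t ^ (2 - 2 / a) := by
    calc u ^ (a - 1) ≤ s ^ (a - 1) := Real.rpow_le_rpow hu0.le hus (by linarith)
      _ = t ^ (2 - 2 / a) := by
        rw [hs, ← Real.rpow_mul ht.le]; congr 1; field_simp
  have b2 : u ^ (a - 2) ≤ t ^ (2 - 4 / a) := by
    calc u ^ (a - 2) ≤ s ^ (a - 2) := Real.rpow_le_rpow hu0.le hus (by linarith)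
      _ = t ^ (2 - 4 / a) := by
        rw [hs, ← Real.rpow_mul ht.le]; congr 1; field_simp; ring
  have c1 : u ^ (a - 1) * t ^ (2 / a - 2) ≤ 1 := by
    calc u ^ (a - 1) * t ^ (2 / a - 2) ≤ t ^ (2 - 2 / a) * t ^ (2 / a - 2) := by gcongr
      _ = 1 := by rw [← Real.rpow_add ht]; simp
  have c2 : u ^ (a - 2) * t ^ (4 / a - 2) ≤ 1 := by
    calc u ^ (a - 2) * t ^ (4 / a - 2) ≤ t ^ (2 - 4 / a) * t ^ (4 / a - 2) := by gcongr
      _ = 1 := by rw [← Real.rpow_add ht]; simp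
  have h2a : 0 ≤ 2 - 2 / a := by
    have : 2 / a ≤ 1 := by rw [div_le_one ha0]; exact ha
    linarith
  have b3 : u ^ (a - 1) ≤ D ^ (2 - 2 / a) * ξ ^ (-2 : ℝ) := by
    calc u ^ (a - 1) ≤ t ^ (2 - 2 / a) := b1
      _ = xn ^ (2 - 2 / a) * ξ ^ (-(2 - 2 / a)) := by
        rw [htdef, Real.div_rpow hxn.le hξ0.le, Real.rpow_neg hξ0.le, div_eq_mul_inv]
      _ ≤ D ^ (2 - 2 / a) * ξ ^ (-2 : ℝ) := by
        have h1 : xn ^ (2 - 2 / a) ≤ D ^ (2 - 2 / a) := Real.rpow_le_rpow hxn.le hxnD h2a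
        have h2 : ξ ^ (-(2 - 2 / a)) ≤ ξ ^ (-2 : ℝ) := by
          apply Real.rpow_le_rpow_of_exponent_ge hξ0 hξ1.le
          have : 0 ≤ 2 / a := by positivity
          linarith
        gcongr
  have hr2 : r ^ 2 ≤ δ * (1 - δ)⁻¹ * u := by
    calc r ^ 2 ≤ δ * s := hcone
      _ = δ * (1 - δ)⁻¹ * ((1 - δ) * s) := by field_simp
      _ ≤ _ := by gcongr
  have c3 : u ^ (a - 2) * r ^ 2 ≤ δ * (1 - δ)⁻¹ * u ^ (a - 1) := by
    calc u ^ (a - 2) * r ^ 2 ≤ u ^ (a - 2) * (δ * (1 - δ)⁻¹ * u) := by gcongr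
      _ = _ := by rw [e3]; ring
  have c4 : u ^ (a - 2) * r ^ 2 ≤ δ * (1 - δ)⁻¹ * (D ^ (2 - 2 / a) * ξ ^ (-2 : ℝ)) :=
    c3.trans (by gcongr)
  have hP : 0 < w ^ (1 - a * b) := by positivity
  have hX : 0 < ξ ^ (-2 : ℝ) := by positivity
  have k1 : 0 ≤ 2 / b := by positivity
  have hb1 : 0 ≤ b - 1 := by linarith
  have ha2 : 0 ≤ a - 2 := by linarith
  have k2 : 0 ≤ 4 * (b - 1) / b ^ 2 := by positivity
  have k3 : 0 ≤ 2 * (a - 2) / (a ^ 2 * b) := by positivity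
  have k4 : 0 ≤ 4 * (b - 1) / (a ^ 2 * b ^ 2) := by positivity
  rw [hWrr, hWnn, e1, e2]
  have m1 := mul_le_mul_of_nonneg_left b3 (mul_nonneg k1 hP.le)
  have m2 := mul_le_mul_of_nonneg_left c4 (mul_nonneg k2 hP.le)
  have m3 := mul_le_mul_of_nonneg_left c1 (mul_nonneg (mul_nonneg k3 hP.le) hX.le)
  have m4 := mul_le_mul_of_nonneg_left c2 (mul_nonneg (mul_nonneg k4 hP.le) hX.le)
  generalize 2 / b = K1 at *
  generalize 4 * (b - 1) / b ^ 2 = K2 at *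
  generalize 2 * (a - 2) / (a ^ 2 * b) = K3 at *
  generalize 4 * (b - 1) / (a ^ 2 * b ^ 2) = K4 at *
  linarith
end

section
/- Let a ≥ 2, 0 < b ≤ 1, δ ∈ (0, 1), ξ > 0, x_n > 0 and r ≥ 0 with r² ≤ δ·(x_n/ξ)^{2/a}. Set w := ((x_n/ξ)^{2/a} − r²)^{1/b}, W_rr := (2/b)·w^{1−b} + (4(b−1)/b²)·w^{1−2b}·r², W_nn := (2(a−2)/(a²b))·w^{1−b}·(x_n/ξ)^{(2/a)−2}·ξ^{−2} + (4(b−1)/(a²b²))·w^{1−2b}·(x_n/ξ)^{(4/a)−2}·ξ^{−2}, and W_rn := (4(1−b)/(ab²))·w^{1−2b}·r·(x_n/ξ)^{(2/a)−1}·ξ^{−1}. Then W_rr·W_nn − W_rn² ≥ [ (δ(a−2) + 1)·(8(b−1)/(a²b³)) + (4(a−2)/(a²b²))·(1−δ)^{a−1} ] · w^{2−b−ab} · ξ^{−2}. -/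
set_option maxHeartbeats 1000000 in
/-- Lower bound `W_rr·W_nn − W_rn² ≥ C₁(a,b,δ)·w^{2−b−ab}·ξ^{−2}` with
`C₁ = (δ(a−2)+1)·(8(b−1)/(a²b³)) + (4(a−2)/(a²b²))·(1−δ)^{a−1}`, for the barrier
`W(r, xₙ) = −((xₙ/ξ)^{2/a} − r²)^{1/b}` (so `w = |W|`) in Step 1-2
(`a ≥ 2`, `0 < b ≤ 1`) of the subsolution construction, at a point satisfying the cone
condition `r² ≤ δ·(xₙ/ξ)^{2/a}`. -/
theorem stmt15 (a b δ ξ xn r : ℝ)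
    (ha : 2 ≤ a) (hb0 : 0 < b) (hb1 : b ≤ 1) (hδ0 : 0 < δ) (hδ1 : δ < 1) (hξ : 0 < ξ)
    (hxn : 0 < xn) (hr : 0 ≤ r) (hcone : r ^ 2 ≤ δ * (xn / ξ) ^ (2 / a))
    (w Wrr Wnn Wrn : ℝ)
    (hw : w = ((xn / ξ) ^ (2 / a) - r ^ 2) ^ (1 / b))
    (hWrr : Wrr = 2 / b * w ^ (1 - b)
        + 4 * (b - 1) / b ^ 2 * w ^ (1 - 2 * b) * r ^ 2)
    (hWnn : Wnn = 2 * (a - 2) / (a ^ 2 * b) * w ^ (1 - b)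
          * (xn / ξ) ^ (2 / a - 2) * ξ ^ (-2 : ℝ)
        + 4 * (b - 1) / (a ^ 2 * b ^ 2) * w ^ (1 - 2 * b)
          * (xn / ξ) ^ (4 / a - 2) * ξ ^ (-2 : ℝ))
    (hWrn : Wrn = 4 * (1 - b) / (a * b ^ 2) * w ^ (1 - 2 * b) * r
        * (xn / ξ) ^ (2 / a - 1) * ξ ^ (-1 : ℝ)) :
    ((δ * (a - 2) + 1) * (8 * (b - 1) / (a ^ 2 * b ^ 3))
          + 4 * (a - 2) / (a ^ 2 * b ^ 2) * (1 - δ) ^ (a - 1))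
        * w ^ (2 - b - a * b) * ξ ^ (-2 : ℝ)
      ≤ Wrr * Wnn - Wrn ^ 2 := by
  have ha0 : 0 < a := by linarith
  have hy : 0 < xn / ξ := div_pos hxn hξ
  generalize xn / ξ = y at *
  obtain ⟨s, hs⟩ : ∃ s, s = y ^ (2 / a) := ⟨_, rfl⟩
  have hs0 : 0 < s := hs ▸ Real.rpow_pos_of_pos hy _
  rw [← hs] at hcone hw
  obtain ⟨u, hu⟩ : ∃ u, u = s - r ^ 2 := ⟨_, rfl⟩
  have hus : (1 - δ) * s ≤ u := by rw [hu]; linarith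
  have hu0 : 0 < u := lt_of_lt_of_le (mul_pos (by linarith) hs0) hus
  have hus' : u ≤ s := by rw [hu]; linarith [sq_nonneg r]
  rw [← hu] at hw
  have hw0 : 0 < w := hw ▸ Real.rpow_pos_of_pos hu0 _
  have hwb : w ^ b = u := by
    rw [hw, ← Real.rpow_mul hu0.le, one_div_mul_cancel hb0.ne', Real.rpow_one]
  obtain ⟨p, hp⟩ : ∃ p, p = w ^ (1 - b) := ⟨_, rfl⟩
  have h2 : w ^ (1 - 2 * b) = p / u := by
    rw [hp, ← hwb, ← Real.rpow_sub hw0]; congr 1; ring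
  obtain ⟨U, hU⟩ : ∃ U, U = u ^ (1 - a) := ⟨_, rfl⟩
  have h3 : w ^ (2 - b - a * b) = p ^ 2 * U := by
    rw [hU, ← hwb, hp, ← Real.rpow_mul hw0.le, ← Real.rpow_natCast, ← Real.rpow_mul hw0.le,
      ← Real.rpow_add hw0]
    congr 1; push_cast; ring
  obtain ⟨Z, hZ⟩ : ∃ Z, Z = y ^ (-1 : ℝ) := ⟨_, rfl⟩
  obtain ⟨X, hX⟩ : ∃ X, X = ξ ^ (-1 : ℝ) := ⟨_, rfl⟩
  have h4 : ξ ^ (-2 : ℝ) = X ^ 2 := by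
    rw [hX, ← Real.rpow_natCast, ← Real.rpow_mul hξ.le]; norm_num
  have hZ2 : y ^ (-2 : ℝ) = Z ^ 2 := by
    rw [hZ, ← Real.rpow_natCast, ← Real.rpow_mul hy.le]; norm_num
  have h5 : y ^ (2 / a - 2) = s * Z ^ 2 := by
    rw [hs, ← hZ2, ← Real.rpow_add hy]; congr 1
  have h6 : y ^ (4 / a - 2) = s ^ 2 * Z ^ 2 := by
    rw [hs, ← hZ2, sq, ← Real.rpow_add hy, ← Real.rpow_add hy]; congr 1; ring
  have h7 : y ^ (2 / a - 1) = s * Z := by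
    rw [hs, hZ, ← Real.rpow_add hy]; congr 1
  have hZs : Z ^ 2 = s ^ (-a) := by
    rw [← hZ2, hs, ← Real.rpow_mul hy.le]; congr 1; field_simp
  have hA : s ^ 2 * Z ^ 2 ≤ u * U := by
    have e1 : s ^ 2 * Z ^ 2 = s ^ (2 - a) := by
      rw [hZs, ← Real.rpow_natCast, ← Real.rpow_add hs0]; congr 1
    have e2 : u * U = u ^ (2 - a) := by
      rw [hU]; nth_rewrite 1 [← Real.rpow_one u]
      rw [← Real.rpow_add hu0]; congr 1; ring
    rw [e1, e2]
    exact Real.rpow_le_rpow_of_nonpos hu0 hus' (by linarith)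
  have hB : (1 - δ) ^ (a - 1) * U ≤ s * Z ^ 2 := by
    have e1 : s * Z ^ 2 = s ^ (1 - a) := by
      rw [hZs]; nth_rewrite 1 [← Real.rpow_one s]
      rw [← Real.rpow_add hs0]; congr 1
    have hd : 0 < 1 - δ := by linarith
    have e2 : U ≤ (1 - δ) ^ (1 - a) * s ^ (1 - a) := by
      rw [hU, ← Real.mul_rpow hd.le hs0.le]
      exact Real.rpow_le_rpow_of_nonpos (by positivity) hus (by linarith)
    calc _ ≤ (1 - δ) ^ (a - 1) * ((1 - δ) ^ (1 - a) * s ^ (1 - a)) := by gcongr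
      _ = _ := by
        rw [← mul_assoc, ← Real.rpow_add hd, e1]
        simp
  have hdet : Wrr * Wnn - Wrn ^ 2 = (4 * (a - 2) / (a ^ 2 * b ^ 2) * (s * Z ^ 2)
      - 8 * (1 - b) / (a ^ 2 * b ^ 3) * ((s + (a - 2) * r ^ 2) * s * Z ^ 2 / u)) * p ^ 2 * X ^ 2 := by
    rw [hWrr, hWnn, hWrn, h2, h4, h5, h6, h7, ← hp, ← hX]
    field_simp
    ring
  have hT : (s + (a - 2) * r ^ 2) * s * Z ^ 2 / u ≤ (δ * (a - 2) + 1) * U := by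
    rw [div_le_iff₀ hu0]
    have h8 : s + (a - 2) * r ^ 2 ≤ (δ * (a - 2) + 1) * s := by
      linarith [mul_le_mul_of_nonneg_left hcone (sub_nonneg.2 ha)]
    have h9 : 0 ≤ δ * (a - 2) + 1 := by linarith [mul_nonneg hδ0.le (sub_nonneg.2 ha)]
    calc _ = (s + (a - 2) * r ^ 2) * (s * Z ^ 2) := by ring
      _ ≤ ((δ * (a - 2) + 1) * s) * (s * Z ^ 2) := by gcongr
      _ = (δ * (a - 2) + 1) * (s ^ 2 * Z ^ 2) := by ring
      _ ≤ (δ * (a - 2) + 1) * (u * U) := by gcongr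
      _ = _ := by ring
  have c1 : 0 ≤ 4 * (a - 2) / (a ^ 2 * b ^ 2) :=
    div_nonneg (by linarith) (by positivity)
  have c2 : 0 ≤ 8 * (1 - b) / (a ^ 2 * b ^ 3) :=
    div_nonneg (by linarith) (by positivity)
  rw [hdet, h3, h4]
  calc _ = (4 * (a - 2) / (a ^ 2 * b ^ 2) * ((1 - δ) ^ (a - 1) * U)
      - 8 * (1 - b) / (a ^ 2 * b ^ 3) * ((δ * (a - 2) + 1) * U)) * p ^ 2 * X ^ 2 := by ring
    _ ≤ _ := by gcongr
end

section
/- Let a ≥ 2, b > 1, δ ∈ (0, 1), 0 < ξ < 1, D > 0, 0 < x_n ≤ D and 0 ≤ r ≤ D with r² ≤ δ·(x_n/ξ)^{2/a}. Set w := ((x_n/ξ)^{2/a} − r²)^{1/b}, W_r := (2/b)·w^{1−b}·r and M_n := (2/(ab))·w^{1−b}·(x_n/ξ)^{(2/a)−1}·ξ^{−1}. Then 1 + W_r² + M_n² ≤ [ 1 + a²·D^{4−4/a} + (a²b²/4)·(1−δ)^{2−a}·D^{2−4/(ab)} ] · M_n². -/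
theorem aux_key (e ξ D xn : ℝ) (he0 : 0 ≤ e) (he2 : e ≤ 2) (hξ0 : 0 < ξ) (hξ1 : ξ < 1)
    (hxn : 0 < xn) (hxnD : xn ≤ D) :
    1 ≤ D ^ e * ((xn / ξ) ^ (-e) * (ξ ^ (-1 : ℝ)) ^ 2) := by
  have hy : 0 < xn / ξ := by positivity
  have h1 : (xn / ξ) ^ e * ξ ^ (2:ℝ) ≤ D ^ e := by
    calc (xn / ξ) ^ e * ξ ^ (2:ℝ) ≤ (xn / ξ) ^ e * ξ ^ e := by
          gcongr ?_ * ?_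
          exact Real.rpow_le_rpow_of_exponent_ge hξ0 hξ1.le he2
      _ = xn ^ e := by
          rw [← Real.mul_rpow hy.le hξ0.le, div_mul_cancel₀ _ hξ0.ne']
      _ ≤ D ^ e := Real.rpow_le_rpow hxn.le hxnD he0
  have hp : 0 < (xn / ξ) ^ e := Real.rpow_pos_of_pos hy e
  rw [Real.rpow_neg hy.le, Real.rpow_neg_one]
  rw [Real.rpow_two] at h1
  have : D ^ e * (((xn / ξ) ^ e)⁻¹ * ξ⁻¹ ^ 2) = D ^ e / ((xn / ξ) ^ e * ξ ^ 2) := by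
    field_simp
  rw [this, le_div_iff₀ (by positivity), one_mul]
  exact h1

/-- Gradient bound `1 + W_r² + |W_n|² ≤ C₆(a,b,δ,D)·|W_n|²` with
`C₆ = 1 + a²·D^{4−4/a} + (a²b²/4)·(1−δ)^{2−a}·D^{2−4/(ab)}`, for the barrier
`W(r, xₙ) = −((xₙ/ξ)^{2/a} − r²)^{1/b}` (so `w = |W|`, `W_r` the radial derivative and
`Mₙ = |W_n|`), at a point with `0 < xₙ ≤ D`, `0 ≤ r ≤ D`, satisfying the cone condition
`r² ≤ δ·(xₙ/ξ)^{2/a}` (here `D` plays the role of `diam Ω`, and `a ≥ 2`, `b > 1`,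
`0 < ξ < 1`). -/
theorem stmt17 (a b δ ξ D xn r : ℝ)
    (ha : 2 ≤ a) (hb : 1 < b) (hδ0 : 0 < δ) (hδ1 : δ < 1)
    (hξ0 : 0 < ξ) (hξ1 : ξ < 1) (hD : 0 < D)
    (hxn : 0 < xn) (hxnD : xn ≤ D) (hr0 : 0 ≤ r) (hrD : r ≤ D)
    (hcone : r ^ 2 ≤ δ * (xn / ξ) ^ (2 / a))
    (w Wr Mn : ℝ)
    (hw : w = ((xn / ξ) ^ (2 / a) - r ^ 2) ^ (1 / b))
    (hWr : Wr = 2 / b * w ^ (1 - b) * r)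
    (hMn : Mn = 2 / (a * b) * w ^ (1 - b) * (xn / ξ) ^ (2 / a - 1) * ξ ^ (-1 : ℝ)) :
    1 + Wr ^ 2 + Mn ^ 2 ≤
      (1 + a ^ 2 * D ^ (4 - 4 / a)
          + a ^ 2 * b ^ 2 / 4 * (1 - δ) ^ (2 - a) * D ^ (2 - 4 / (a * b)))
        * Mn ^ 2 := by
  have ha0 : 0 < a := by linarith
  have hb0 : 0 < b := by linarith
  have hy : 0 < xn / ξ := by positivity
  have hs : 0 < (xn / ξ) ^ (2 / a) := Real.rpow_pos_of_pos hy _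
  have hw0 : 0 < (xn / ξ) ^ (2 / a) - r ^ 2 := by nlinarith
  have hab : 2 ≤ a * b := by nlinarith
  have hQ : ((xn / ξ) ^ (2 / a - 1)) ^ 2 = (xn / ξ) ^ (-(2 - 4 / a)) := by
    rw [← Real.rpow_natCast, ← Real.rpow_mul hy.le]
    congr 1
    push_cast
    ring
  have k1 := aux_key (2 - 4 / a) ξ D xn
    (by rw [sub_nonneg, div_le_iff₀ ha0]; linarith)
    (by have : 0 < 4 / a := by positivity
        linarith) hξ0 hξ1 hxn hxnD
  have k2 := aux_key (2 - 4 / (a * b)) ξ D xn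
    (by rw [sub_nonneg, div_le_iff₀ (by positivity)]; linarith)
    (by have : 0 < 4 / (a * b) := by positivity
        linarith) hξ0 hξ1 hxn hxnD
  have hP : (xn / ξ) ^ (2 / a * ((2 - 2 * b) / b)) ≤ (w ^ (1 - b)) ^ 2 := by
    have : (w ^ (1 - b)) ^ 2 = ((xn / ξ) ^ (2 / a) - r ^ 2) ^ ((2 - 2 * b) / b) := by
      rw [hw, ← Real.rpow_mul hw0.le, ← Real.rpow_natCast, ← Real.rpow_mul hw0.le]
      congr 1
      push_cast
      field_simp
    rw [this, Real.rpow_mul hy.le]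
    apply Real.rpow_le_rpow_of_nonpos hw0
    · nlinarith [sq_nonneg r]
    · apply div_nonpos_of_nonpos_of_nonneg <;> linarith
  have hPQ : (xn / ξ) ^ (-(2 - 4 / (a * b))) =
      (xn / ξ) ^ (2 / a * ((2 - 2 * b) / b)) * (xn / ξ) ^ (-(2 - 4 / a)) := by
    rw [← Real.rpow_add hy]
    congr 1
    field_simp
    ring
  have hD4 : D ^ (4 - 4 / a) = D ^ 2 * D ^ (2 - 4 / a) := by
    rw [← Real.rpow_natCast, ← Real.rpow_add hD]
    congr 1
    push_cast
    ring
  have hδ : 1 ≤ (1 - δ) ^ (2 - a) :=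
    Real.one_le_rpow_of_pos_of_le_one_of_nonpos (by linarith) (by linarith) (by linarith)
  rw [hPQ] at k2
  rw [← hQ] at k1 k2
  rw [hD4]
  generalize (xn / ξ) ^ (2 / a - 1) = Q at *
  generalize ξ ^ (-1 : ℝ) = R at *
  generalize w ^ (1 - b) = P at *
  generalize (xn / ξ) ^ (2 / a * ((2 - 2 * b) / b)) = P' at *
  have hE : 0 < D ^ (2 - 4 / (a * b)) := Real.rpow_pos_of_pos hD _
  generalize D ^ (2 - 4 / (a * b)) = E at *
  generalize D ^ (2 - 4 / a) = F at *
  generalize (1 - δ) ^ (2 - a) = G at *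
  have c1 : Wr ^ 2 ≤ a ^ 2 * (D ^ 2 * F) * Mn ^ 2 := by
    have e1 : a ^ 2 * (D ^ 2 * F) * Mn ^ 2 = (2 / b * P) ^ 2 * (D ^ 2 * (F * (Q ^ 2 * R ^ 2))) := by
      rw [hMn]; field_simp
    rw [e1, hWr, mul_pow _ r]
    have : r ^ 2 ≤ D ^ 2 := by gcongr
    have : D ^ 2 ≤ D ^ 2 * (F * (Q ^ 2 * R ^ 2)) := le_mul_of_one_le_right (by positivity) k1
    gcongr
    linarith
  have c2 : 1 ≤ a ^ 2 * b ^ 2 / 4 * G * E * Mn ^ 2 := by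
    have e2 : a ^ 2 * b ^ 2 / 4 * G * E * Mn ^ 2 = G * (E * (P ^ 2 * Q ^ 2 * R ^ 2)) := by
      rw [hMn]; field_simp; ring
    rw [e2]
    have : E * (P' * Q ^ 2 * R ^ 2) ≤ E * (P ^ 2 * Q ^ 2 * R ^ 2) := by gcongr
    exact one_le_mul_of_one_le_of_one_le hδ (k2.trans this)
  linarith
end
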